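/- arXiv:2204.07902 — 2 statements merged into one kernel-verified Lean document; each statement's English description precedes it below -/
import Mathlib

section
/- The set {v ∈ W·ρ : ⟨v,γi⟩ > 0 for all 1 ≤ i ≤ 6} has exactly 56 elements. (Its elements are the half sums ρ^{(j)}, 0 ≤ j ≤ 55, of the 56 positive systems of Φ containing Δ⁺(k).) -/
open scoped BigOperators

namespace E7

noncomputable section

/-- The standard inner product on ℝ⁸. -/
def ip (x y : Fin 8 → ℝ) : ℝ := ∑ i, x i * y i

/-- The simple roots α₁,…,α₇ of E₇ (indexed by `Fin 7`). -/
def sroot : Fin 7 → Fin 8 → ℝ :=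
  ![![1/2, -1/2, -1/2, -1/2, -1/2, -1/2, -1/2, 1/2],
    ![1, 1, 0, 0, 0, 0, 0, 0],
    ![-1, 1, 0, 0, 0, 0, 0, 0],
    ![0, -1, 1, 0, 0, 0, 0, 0],
    ![0, 0, -1, 1, 0, 0, 0, 0],
    ![0, 0, 0, -1, 1, 0, 0, 0],
    ![0, 0, 0, 0, -1, 1, 0, 0]]

/-- The root lattice `Q`: integer linear combinations of the simple roots. -/
def latQ : Set (Fin 8 → ℝ) := {v | ∃ c : Fin 7 → ℤ, v = ∑ j, (c j : ℝ) • sroot j}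

/-- The E₇ root system `Φ = {v ∈ Q : ⟨v,v⟩ = 2}`. -/
def Phi : Set (Fin 8 → ℝ) := {v | v ∈ latQ ∧ ip v v = 2}

/-- The vector ζ. -/
def zeta : Fin 8 → ℝ := ![0, 0, 0, 0, 0, 1, -1/2, 1/2]

/-- The positive roots Δ⁺: roots that are nonnegative integer combinations
of the simple roots. -/
def PhiPos : Set (Fin 8 → ℝ) :=
  {v | v ∈ Phi ∧ ∃ c : Fin 7 → ℕ, v = ∑ j, (c j : ℝ) • sroot j}

/-- The compact positive roots Δ⁺(k) = {α ∈ Δ⁺ : ⟨α,ζ⟩ = 0}. -/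
def PhiPosK : Set (Fin 8 → ℝ) := {v | v ∈ PhiPos ∧ ip v zeta = 0}

/-- The Weyl group `W` of E₇: the subgroup of linear automorphisms of ℝ⁸
generated by the reflections `s_α : v ↦ v − ⟨v,α⟩α` for `α ∈ Φ`. -/
def W : Subgroup ((Fin 8 → ℝ) ≃ₗ[ℝ] (Fin 8 → ℝ)) :=
  Subgroup.closure {g | ∃ a ∈ Phi, ∀ v, g v = v - ip v a • a}

/-- The subgroup of `W` generated by the six compact simple reflections
`s_{γ₁},…,s_{γ₆}` (the Weyl group of E₆, i.e. of k). -/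
def WK : Subgroup ((Fin 8 → ℝ) ≃ₗ[ℝ] (Fin 8 → ℝ)) :=
  Subgroup.closure
    {g | ∃ i : Fin 6, ∀ v, g v = v - ip v (sroot i.castSucc) • sroot i.castSucc}

end

/-! ### The root lattice in simple root coordinates -/

lemma ip_eq_dotProduct (x y : Fin 8 → ℝ) : ip x y = x ⬝ᵥ y := rfl

/-- The element of the root lattice with given coordinates in the simple roots. -/
noncomputable def lat (c : Fin 7 → ℤ) : Fin 8 → ℝ := ∑ j, (c j : ℝ) • sroot j

/-- The inner product in simple root coordinates, given by the Cartan matrix of `E₇`. -/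
def form (c d : Fin 7 → ℤ) : ℤ :=
  2 * (c 0 * d 0 + c 1 * d 1 + c 2 * d 2 + c 3 * d 3 + c 4 * d 4 + c 5 * d 5 + c 6 * d 6)
    - (c 0 * d 2 + c 2 * d 0) - (c 2 * d 3 + c 3 * d 2) - (c 1 * d 3 + c 3 * d 1)
    - (c 3 * d 4 + c 4 * d 3) - (c 4 * d 5 + c 5 * d 4) - (c 5 * d 6 + c 6 * d 5)

/-- The height of a vector in simple root coordinates. -/
def height (c : Fin 7 → ℤ) : ℤ := c 0 + c 1 + c 2 + c 3 + c 4 + c 5 + c 6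

/-- The coordinate vector of a simple root. -/
def unit (i : Fin 7) : Fin 7 → ℤ := fun j => if j = i then 1 else 0

lemma height_eq_sum (c : Fin 7 → ℤ) : height c = ∑ i, c i := by
  simp [height, Fin.sum_univ_succ]; ring

lemma lat_add (c d : Fin 7 → ℤ) : lat (c + d) = lat c + lat d := by
  simp [lat, add_smul, Finset.sum_add_distrib]

lemma lat_sub (c d : Fin 7 → ℤ) : lat (c - d) = lat c - lat d := by
  simp [lat, sub_smul, Finset.sum_sub_distrib]

lemma lat_neg (c : Fin 7 → ℤ) : lat (-c) = -lat c := by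
  simp [lat, neg_smul, Finset.sum_neg_distrib]

lemma lat_zero : lat 0 = 0 := by simp [lat]

lemma lat_zsmul (k : ℤ) (c : Fin 7 → ℤ) : lat (k • c) = (k : ℝ) • lat c := by
  simp [lat, mul_smul, Finset.smul_sum]

lemma lat_unit (i : Fin 7) : lat (unit i) = sroot i := by
  simp [lat, unit, ite_smul]

lemma ip_lat (x : Fin 8 → ℝ) (c : Fin 7 → ℤ) :
    ip x (lat c) = ∑ i, (c i : ℝ) * ip x (sroot i) := by
  simp only [ip_eq_dotProduct, lat, dotProduct_sum, dotProduct_smul, smul_eq_mul]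

lemma ip_lat_lat (c d : Fin 7 → ℤ) : ip (lat c) (lat d) = form c d := by
  simp [ip, lat, form, sroot, Fin.sum_univ_succ, Fin.succ]
  ring

lemma form_sub_self (c d : Fin 7 → ℤ) :
    form (c - d) (c - d) = form c c - 2 * form c d + form d d := by
  simp only [form, Pi.sub_apply]; ring

lemma form_unit_self (i : Fin 7) : form (unit i) (unit i) = 2 := by
  revert i; decide

lemma form_self_eq_sum (c : Fin 7 → ℤ) : form c c = ∑ i, c i * form c (unit i) := by
  simp only [Fin.sum_univ_seven, form, unit, Fin.isValue, Fin.reduceEq, if_true, if_false]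
  ring

lemma four_mul_form_self (c : Fin 7 → ℤ) :
    4 * form c c = (c 0 + 2 * c 1 - 2 * c 2) ^ 2 + (-c 0 + 2 * c 1 + 2 * c 2 - 2 * c 3) ^ 2
      + (-c 0 + 2 * c 3 - 2 * c 4) ^ 2 + (-c 0 + 2 * c 4 - 2 * c 5) ^ 2
      + (-c 0 + 2 * c 5 - 2 * c 6) ^ 2 + (-c 0 + 2 * c 6) ^ 2 + 2 * c 0 ^ 2 := by
  simp only [form]; ring

lemma form_self_nonneg (c : Fin 7 → ℤ) : 0 ≤ form c c := by
  have h := four_mul_form_self c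
  have : 0 ≤ 4 * form c c := by rw [h]; positivity
  linarith

lemma eq_zero_of_form_self (c : Fin 7 → ℤ) (hc : form c c ≤ 0) : c = 0 := by
  have h := four_mul_form_self c
  have h0 : c 0 = 0 := by
    refine pow_eq_zero_iff two_ne_zero |>.1 (le_antisymm ?_ (sq_nonneg _)); nlinarith
  rw [h0] at h
  have h6 : -0 + 2 * c 6 = 0 := by
    refine pow_eq_zero_iff two_ne_zero |>.1 (le_antisymm ?_ (sq_nonneg _)); nlinarith
  have h5 : -0 + 2 * c 5 - 2 * c 6 = 0 := by
    refine pow_eq_zero_iff two_ne_zero |>.1 (le_antisymm ?_ (sq_nonneg _)); nlinarith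
  have h4 : -0 + 2 * c 4 - 2 * c 5 = 0 := by
    refine pow_eq_zero_iff two_ne_zero |>.1 (le_antisymm ?_ (sq_nonneg _)); nlinarith
  have h3 : -0 + 2 * c 3 - 2 * c 4 = 0 := by
    refine pow_eq_zero_iff two_ne_zero |>.1 (le_antisymm ?_ (sq_nonneg _)); nlinarith
  have h2 : -0 + 2 * c 1 + 2 * c 2 - 2 * c 3 = 0 := by
    refine pow_eq_zero_iff two_ne_zero |>.1 (le_antisymm ?_ (sq_nonneg _)); nlinarith
  have h1 : 0 + 2 * c 1 - 2 * c 2 = 0 := by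
    refine pow_eq_zero_iff two_ne_zero |>.1 (le_antisymm ?_ (sq_nonneg _)); nlinarith
  ext i
  fin_cases i <;> simp <;> omega

lemma two_le_form_self {c : Fin 7 → ℤ} (hc : c ≠ 0) : 2 ≤ form c c := by
  have h : ¬ form c c ≤ 0 := fun h => hc (eq_zero_of_form_self c h)
  have h2 : ∃ k, form c c = 2 * k := ⟨c 0 ^ 2 + c 1 ^ 2 + c 2 ^ 2 + c 3 ^ 2 + c 4 ^ 2 + c 5 ^ 2
    + c 6 ^ 2 - c 0 * c 2 - c 2 * c 3 - c 1 * c 3 - c 3 * c 4 - c 4 * c 5 - c 5 * c 6, by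
      simp only [form]; ring⟩
  omega

lemma lat_injective : Function.Injective lat := by
  intro c d h
  have h0 : ip (lat (c - d)) (lat (c - d)) = 0 := by
    rw [lat_sub, h, sub_self]; simp [ip]
  rw [ip_lat_lat] at h0
  exact sub_eq_zero.1 (eq_zero_of_form_self _ (by exact_mod_cast h0.le))

/-! ### Roots -/

lemma mem_Phi_iff {v : Fin 8 → ℝ} : v ∈ Phi ↔ ∃ c, form c c = 2 ∧ v = lat c := by
  constructor
  · rintro ⟨⟨c, rfl⟩, h⟩
    refine ⟨c, ?_, rfl⟩
    have := ip_lat_lat c c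
    rw [lat, h] at this
    exact_mod_cast this.symm
  · rintro ⟨c, h, rfl⟩
    exact ⟨⟨c, rfl⟩, by rw [ip_lat_lat, h]; norm_num⟩

lemma mem_PhiPos_iff {v : Fin 8 → ℝ} : v ∈ PhiPos ↔ ∃ c, form c c = 2 ∧ 0 ≤ c ∧ v = lat c := by
  constructor
  · rintro ⟨hv, c, rfl⟩
    obtain ⟨d, hd, h⟩ := mem_Phi_iff.1 hv
    have hc : lat (fun j => (c j : ℤ)) = lat d := by rw [← h]; simp [lat]
    refine ⟨d, hd, ?_, h⟩
    rw [← lat_injective hc]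
    intro j
    simp
  · rintro ⟨c, h, h0, rfl⟩
    refine ⟨mem_Phi_iff.2 ⟨c, h, rfl⟩, fun j => (c j).toNat, ?_⟩
    refine Finset.sum_congr rfl fun j _ => ?_
    congr 1
    exact_mod_cast (Int.toNat_of_nonneg (h0 j)).symm

/-- Every root is positive or negative. -/
lemma nonneg_or_nonpos_of_root {c : Fin 7 → ℤ} (hc : form c c = 2) : 0 ≤ c ∨ c ≤ 0 := by
  have hsub : c = c⁺ - c⁻ := (posPart_sub_negPart c).symm
  have hp : ∀ i, 0 ≤ c⁺ i := posPart_nonneg c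
  have hn : ∀ i, 0 ≤ c⁻ i := negPart_nonneg c
  have hpn : ∀ i, c⁺ i * c⁻ i = 0 := by
    intro i
    rw [Pi.posPart_apply, Pi.negPart_apply]
    rcases le_total 0 (c i) with h | h
    · simp [negPart_eq_zero.2 h]
    · simp [posPart_eq_zero.2 h]
  have hform : form c⁺ c⁻ ≤ 0 := by
    simp only [form, hpn]
    have : ∀ i j, 0 ≤ c⁺ i * c⁻ j := fun i j => mul_nonneg (hp i) (hn j)
    linarith [this 0 2, this 2 0, this 2 3, this 3 2, this 1 3, this 3 1, this 3 4, this 4 3,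
      this 4 5, this 5 4, this 5 6, this 6 5]
  by_contra! h
  have h1 : c⁺ ≠ 0 := fun h' => h.2 (posPart_eq_zero.1 h')
  have h2 : c⁻ ≠ 0 := fun h' => h.1 (negPart_eq_zero.1 h')
  have := form_sub_self c⁺ c⁻
  rw [← hsub] at this
  linarith [two_le_form_self h1, two_le_form_self h2]

/-- Two roots pairing to at least `2` are equal. -/
lemma eq_of_two_le_form {c d : Fin 7 → ℤ} (hc : form c c = 2) (hd : form d d = 2)
    (h : 2 ≤ form c d) : c = d := by
  refine sub_eq_zero.1 (eq_zero_of_form_self _ ?_)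
  rw [form_sub_self]
  linarith

lemma neg_one_le_form {c d : Fin 7 → ℤ} (hc : form c c = 2) (hd : form d d = 2)
    (h : c ≠ -d) : -1 ≤ form c d := by
  by_contra! h'
  refine h (eq_of_two_le_form hc ?_ ?_)
  · simpa [form] using hd
  · have : form c (-d) = - form c d := by simp only [form, Pi.neg_apply]; ring
    omega

/-- The positive roots involving the last simple root. -/
def noncompactRoots : List (Fin 7 → ℤ) :=
  [![0, 0, 0, 0, 0, 0, 1], ![0, 0, 0, 0, 0, 1, 1], ![0, 0, 0, 0, 1, 1, 1],
   ![0, 0, 0, 1, 1, 1, 1], ![0, 1, 0, 1, 1, 1, 1], ![0, 0, 1, 1, 1, 1, 1],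
   ![0, 1, 1, 1, 1, 1, 1], ![1, 0, 1, 1, 1, 1, 1], ![1, 1, 1, 1, 1, 1, 1],
   ![0, 1, 1, 2, 1, 1, 1], ![1, 1, 1, 2, 1, 1, 1], ![0, 1, 1, 2, 2, 1, 1],
   ![1, 1, 2, 2, 1, 1, 1], ![1, 1, 1, 2, 2, 1, 1], ![0, 1, 1, 2, 2, 2, 1],
   ![1, 1, 2, 2, 2, 1, 1], ![1, 1, 1, 2, 2, 2, 1], ![1, 1, 2, 3, 2, 1, 1],
   ![1, 1, 2, 2, 2, 2, 1], ![1, 2, 2, 3, 2, 1, 1], ![1, 1, 2, 3, 2, 2, 1],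
   ![1, 2, 2, 3, 2, 2, 1], ![1, 1, 2, 3, 3, 2, 1], ![1, 2, 2, 3, 3, 2, 1],
   ![1, 2, 2, 4, 3, 2, 1], ![1, 2, 3, 4, 3, 2, 1], ![2, 2, 3, 4, 3, 2, 1]]

lemma unit_add_mem_noncompactRoots : ∀ r ∈ noncompactRoots, ∀ i : Fin 7, form r (unit i) = -1 →
    r + unit i ∈ noncompactRoots := by
  decide +kernel

/-- The coefficient of the last simple root in a root is at most `1`. -/
lemma coeff_six_le_one {c : Fin 7 → ℤ} (hc : form c c = 2) : c 6 ≤ 1 := by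
  have h := form_self_nonneg (3 • c - c 6 • ![2, 3, 4, 6, 5, 4, 3])
  have h' : form (3 • c - c 6 • ![2, 3, 4, 6, 5, 4, 3]) (3 • c - c 6 • ![2, 3, 4, 6, 5, 4, 3])
      = 9 * form c c - 6 * c 6 ^ 2 := by
    simp [form]; ring
  rw [h', hc] at h
  nlinarith

lemma mem_noncompactRoots {c : Fin 7 → ℤ} (hc : form c c = 2) (h0 : 0 ≤ c) (h6 : 0 < c 6) :
    c ∈ noncompactRoots := by
  obtain ⟨n, hn⟩ : ∃ n : ℕ, height c ≤ n := ⟨(height c).toNat, Int.self_le_toNat _⟩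
  induction n generalizing c with
  | zero =>
    have := fun i => h0 i
    simp only [Pi.zero_apply] at this
    simp only [height] at hn
    push_cast at hn
    linarith [this 0, this 1, this 2, this 3, this 4, this 5]
  | succ n ih =>
    by_cases hu : c = unit 6
    · subst hu; decide
    have h61 := coeff_six_le_one hc
    have hlt : ∀ i, c ≠ unit i → form c (unit i) ≤ 1 := by
      intro i hi
      by_contra! h
      exact hi (eq_of_two_le_form hc (form_unit_self i) h)
    obtain ⟨i, hi6, hi⟩ : ∃ i, i ≠ 6 ∧ 0 < c i * form c (unit i) := by
      by_contra! h
      have hs := form_self_eq_sum c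
      rw [← Finset.add_sum_erase _ _ (Finset.mem_univ (6 : Fin 7)), hc] at hs
      have := Finset.sum_nonpos (s := Finset.univ.erase (6 : Fin 7))
        (f := fun i => c i * form c (unit i)) fun i hi => h i (Finset.ne_of_mem_erase hi)
      nlinarith [hlt 6 hu]
    have hci : 0 < c i := lt_of_le_of_ne (h0 i) fun h => by simp [← h] at hi
    have hfi : form c (unit i) = 1 := by
      have : 0 < form c (unit i) := pos_of_mul_pos_right hi hci.le
      have : c ≠ unit i := by
        rintro rfl
        simp [unit, hi6.symm] at h6
      have := hlt i this
      omega
    have hsub : form (c - unit i) (c - unit i) = 2 := by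
      rw [form_sub_self, form_unit_self]; omega
    have hmem : c - unit i ∈ noncompactRoots := by
      apply ih hsub
      · intro j
        by_cases hj : j = i
        · subst hj; simp [unit]; omega
        · simpa [unit, hj] using h0 j
      · simpa [unit, hi6.symm] using h6
      · have : height (c - unit i) = height c - 1 := by
          simp [height_eq_sum, unit, Finset.sum_sub_distrib]
        push_cast at hn
        omega
    have := unit_add_mem_noncompactRoots _ hmem i (by
      have : form (c - unit i) (unit i) = form c (unit i) - form (unit i) (unit i) := by
        simp only [form, Pi.sub_apply]; ring
      rw [this, form_unit_self]; omega)
    simpa using this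

/-! ### The Weyl group -/

lemma exists_reflection_mem_W {c : Fin 7 → ℤ} (hc : form c c = 2) :
    ∃ g ∈ W, ∀ v, g v = v - ip v (lat c) • lat c := by
  let f : (Fin 8 → ℝ) →ₗ[ℝ] ℝ :=
    { toFun := fun v => ip v (lat c)
      map_add' := fun x y => by simp [ip_eq_dotProduct, add_dotProduct]
      map_smul' := fun r x => by simp [ip_eq_dotProduct, smul_dotProduct] }
  have hf : f (lat c) = 2 := by
    change ip (lat c) (lat c) = 2
    rw [ip_lat_lat, hc]; norm_num
  have hg : ∀ v, Module.reflection hf v = v - ip v (lat c) • lat c := fun v =>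
    Module.reflection_apply v hf
  exact ⟨Module.reflection hf, Subgroup.subset_closure ⟨lat c, mem_Phi_iff.2 ⟨c, hc, rfl⟩, hg⟩, hg⟩

lemma ip_reflection {a : Fin 8 → ℝ} (ha : ip a a = 2) (x y : Fin 8 → ℝ) :
    ip (x - ip x a • a) (y - ip y a • a) = ip x y := by
  simp only [ip_eq_dotProduct] at *
  simp only [sub_dotProduct, dotProduct_sub, smul_dotProduct, dotProduct_smul, ha, smul_eq_mul,
    dotProduct_comm a y]
  ring

lemma W_ip {g : (Fin 8 → ℝ) ≃ₗ[ℝ] (Fin 8 → ℝ)} (hg : g ∈ W) (x y : Fin 8 → ℝ) :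
    ip (g x) (g y) = ip x y := by
  induction hg using Subgroup.closure_induction generalizing x y with
  | mem g hg =>
    obtain ⟨a, ha, h⟩ := hg
    rw [h, h, ip_reflection ha.2]
  | one => rfl
  | mul g h _ _ hg hh => rw [LinearEquiv.mul_apply, LinearEquiv.mul_apply, hg, hh]
  | inv g _ hg =>
    rw [← hg, ← LinearEquiv.mul_apply, ← LinearEquiv.mul_apply, mul_inv_cancel]; rfl

lemma W_inv_ip {g : (Fin 8 → ℝ) ≃ₗ[ℝ] (Fin 8 → ℝ)} (hg : g ∈ W) (x y : Fin 8 → ℝ) :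
    ip (g x) y = ip x (g⁻¹ y) := by
  rw [← W_ip hg x, ← LinearEquiv.mul_apply, mul_inv_cancel]; rfl

lemma W_lat {g : (Fin 8 → ℝ) ≃ₗ[ℝ] (Fin 8 → ℝ)} (hg : g ∈ W) (c : Fin 7 → ℤ) :
    ∃ d, form d d = form c c ∧ g (lat c) = lat d := by
  suffices (∀ c, ∃ d, g (lat c) = lat d) ∧ ∀ c, ∃ d, g⁻¹ (lat c) = lat d by
    obtain ⟨d, hd⟩ := this.1 c
    refine ⟨d, ?_, hd⟩
    have := W_ip hg (lat c) (lat c)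
    rw [hd, ip_lat_lat, ip_lat_lat] at this
    exact_mod_cast this
  clear c
  induction hg using Subgroup.closure_induction with
  | mem g hg =>
    obtain ⟨a, ha, h⟩ := hg
    obtain ⟨r, hr, rfl⟩ := mem_Phi_iff.1 ha
    have hlat : ∀ c, g (lat c) = lat (c - form c r • r) := fun c => by
      rw [h, ip_lat_lat, lat_sub, lat_zsmul]
    refine ⟨fun c => ⟨_, hlat c⟩, fun c => ⟨c - form c r • r, ?_⟩⟩
    rw [← hlat]
    have hgg : g (g (lat c)) = lat c := by
      rw [h, h]
      have := ha.2
      simp only [ip_eq_dotProduct] at *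
      simp only [sub_dotProduct, smul_dotProduct, this, smul_eq_mul]
      module
    conv_lhs => rw [← hgg]
    rw [← LinearEquiv.mul_apply, inv_mul_cancel]; rfl
  | one => exact ⟨fun c => ⟨c, rfl⟩, fun c => ⟨c, rfl⟩⟩
  | mul g h _ _ hg hh =>
    refine ⟨fun c => ?_, fun c => ?_⟩
    · obtain ⟨d, hd⟩ := hh.1 c
      obtain ⟨e, he⟩ := hg.1 d
      exact ⟨e, by rw [LinearEquiv.mul_apply, hd, he]⟩
    · obtain ⟨d, hd⟩ := hg.2 c
      obtain ⟨e, he⟩ := hh.2 d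
      exact ⟨e, by rw [mul_inv_rev, LinearEquiv.mul_apply, hd, he]⟩
  | inv g _ hg => exact ⟨hg.2, by simpa using hg.1⟩

/-! ### The half sum of positive roots -/

section Rho

variable {sP : Finset (Fin 8 → ℝ)}

/-- A simple reflection permutes the positive roots other than its own simple root. -/
lemma simple_reflection_mem_PhiPos {x : Fin 8 → ℝ} {i : Fin 7} (hx : x ∈ PhiPos)
    (hxi : x ≠ sroot i) :
    x - ip x (sroot i) • sroot i ∈ PhiPos ∧ x - ip x (sroot i) • sroot i ≠ sroot i := by
  obtain ⟨c, hc, h0, rfl⟩ := mem_PhiPos_iff.1 hx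
  rw [← lat_unit, ip_lat_lat, ← lat_zsmul, ← lat_sub]
  rw [← lat_unit] at hxi
  have hui := form_unit_self i
  have hnorm : form (c - form c (unit i) • unit i) (c - form c (unit i) • unit i) = 2 := by
    have h : form c (form c (unit i) • unit i) = form c (unit i) * form c (unit i) := by
      simp only [form, Pi.smul_apply, smul_eq_mul]; ring
    have h' : form (form c (unit i) • unit i) (form c (unit i) • unit i)
        = form c (unit i) ^ 2 * form (unit i) (unit i) := by
      simp only [form, Pi.smul_apply, smul_eq_mul]; ring
    rw [form_sub_self, h, h', hui, hc]; ring
  constructor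
  · refine mem_PhiPos_iff.2 ⟨_, hnorm, ?_, rfl⟩
    refine (nonneg_or_nonpos_of_root hnorm).resolve_right fun hneg => hxi ?_
    have hck : c = c i • unit i := by
      ext j
      by_cases hj : j = i
      · subst hj; simp [unit]
      · have h1 := h0 j
        have h2 := hneg j
        simp [unit, hj] at h1 h2 ⊢
        omega
    have hci : c i ^ 2 = 1 := by
      have : form (c i • unit i) (c i • unit i) = c i ^ 2 * form (unit i) (unit i) := by
        simp only [form, Pi.smul_apply, smul_eq_mul]; ring
      rw [← hck, hc, hui] at this
      omega
    have h1 : c i = 1 := by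
      have := h0 i
      simp only [Pi.zero_apply] at this
      nlinarith
    rw [hck, h1, one_smul]
  · intro h
    have h := lat_injective h
    rw [h] at hnorm
    have hck : c = (1 + form c (unit i)) • unit i := by
      rw [add_smul, one_smul]; exact sub_eq_iff_eq_add.1 h
    have hf : form c (unit i) = (1 + form c (unit i)) * form (unit i) (unit i) := by
      conv_lhs => rw [hck]
      simp only [form, Pi.smul_apply, smul_eq_mul]; ring
    rw [hui] at hf
    have hi := h0 i
    rw [hck] at hi
    simp [unit] at hi
    omega

lemma ip_rho_sroot (hsP : (sP : Set (Fin 8 → ℝ)) = PhiPos) (i : Fin 7) :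
    ip ((1 / 2 : ℝ) • ∑ x ∈ sP, x) (sroot i) = 1 := by
  have hmem : ∀ x, x ∈ sP ↔ x ∈ PhiPos := fun x => by rw [← hsP, Finset.mem_coe]
  have hii : ip (sroot i) (sroot i) = 2 := by
    rw [← lat_unit, ip_lat_lat, form_unit_self]; norm_num
  have hi : sroot i ∈ sP := by
    rw [hmem, ← lat_unit]
    exact mem_PhiPos_iff.2 ⟨_, form_unit_self i, fun j => by simp [unit]; split_ifs <;> simp, rfl⟩
  have hip : ∀ x, ip (x - ip x (sroot i) • sroot i) (sroot i) = - ip x (sroot i) := fun x => by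
    simp only [ip_eq_dotProduct] at *
    rw [sub_dotProduct, smul_dotProduct, hii, smul_eq_mul]
    ring
  have hsum : ∑ x ∈ sP.erase (sroot i), ip x (sroot i) = 0 := by
    refine Finset.sum_involution (fun x _ => x - ip x (sroot i) • sroot i) ?_ ?_ ?_ ?_
    · intro x _
      rw [hip, add_neg_cancel]
    · intro x _ h h'
      have := hip x
      rw [h'] at this
      exact h (by linarith)
    · intro x hx
      obtain ⟨hx1, hx2⟩ := Finset.mem_erase.1 hx
      obtain ⟨h1, h2⟩ := simple_reflection_mem_PhiPos ((hmem x).1 hx2) hx1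
      exact Finset.mem_erase.2 ⟨h2, (hmem _).2 h1⟩
    · intro x _
      simp only [hip]
      module
  have : ip ((1 / 2 : ℝ) • ∑ x ∈ sP, x) (sroot i) = 1 / 2 * ∑ x ∈ sP, ip x (sroot i) := by
    simp only [ip_eq_dotProduct, smul_dotProduct, sum_dotProduct, smul_eq_mul]
  rw [this, ← Finset.add_sum_erase _ _ hi, hsum, hii]
  norm_num

lemma ip_rho_nonneg (hsP : (sP : Set (Fin 8 → ℝ)) = PhiPos) {d : Fin 8 → ℝ}
    (hd : ∀ i, 0 ≤ ip d (sroot i)) : 0 ≤ ip ((1 / 2 : ℝ) • ∑ x ∈ sP, x) d := by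
  have : ip ((1 / 2 : ℝ) • ∑ x ∈ sP, x) d = 1 / 2 * ∑ x ∈ sP, ip x d := by
    simp only [ip_eq_dotProduct, smul_dotProduct, sum_dotProduct, smul_eq_mul]
  rw [this]
  refine mul_nonneg (by norm_num) (Finset.sum_nonneg fun x hx => ?_)
  have hx : x ∈ PhiPos := by rw [← hsP]; exact hx
  obtain ⟨c, -, h0, rfl⟩ := mem_PhiPos_iff.1 hx
  rw [ip_eq_dotProduct, dotProduct_comm, ← ip_eq_dotProduct, ip_lat]
  exact Finset.sum_nonneg fun i _ => mul_nonneg (by exact_mod_cast h0 i) (hd i)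

end Rho

/-! ### Strictly dominant vectors in the orbit -/

lemma ip_self_nonneg (x : Fin 8 → ℝ) : 0 ≤ ip x x :=
  Finset.sum_nonneg fun i _ => mul_self_nonneg (x i)

lemma eq_zero_of_ip_self {x : Fin 8 → ℝ} (h : ip x x ≤ 0) : x = 0 :=
  dotProduct_self_eq_zero.1 (le_antisymm h (ip_self_nonneg x))

lemma ip_eq_height {ρ : Fin 8 → ℝ} (hρ : ∀ i, ip ρ (sroot i) = 1) (c : Fin 7 → ℤ) :
    ip ρ (lat c) = height c := by
  simp [ip_lat, hρ, height_eq_sum]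

lemma height_pos {c : Fin 7 → ℤ} (h0 : 0 ≤ c) (hc : c ≠ 0) : 0 < height c := by
  rw [height_eq_sum]
  refine Finset.sum_pos' (fun i _ => h0 i) ?_
  by_contra! h
  exact hc (le_antisymm (fun i => h i (Finset.mem_univ i)) h0)

lemma root_ne_zero {c : Fin 7 → ℤ} (hc : form c c = 2) : c ≠ 0 := by
  rintro rfl
  simp [form] at hc

/-- Elements of the orbit of `ρ` pair with roots to nonzero integers. -/
lemma exists_int_ip_orbit {ρ : Fin 8 → ℝ} (hρ : ∀ i, ip ρ (sroot i) = 1)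
    {g : (Fin 8 → ℝ) ≃ₗ[ℝ] (Fin 8 → ℝ)} (hg : g ∈ W) {c : Fin 7 → ℤ} (hc : form c c = 2) :
    ∃ k : ℤ, k ≠ 0 ∧ ip (g ρ) (lat c) = k := by
  obtain ⟨d, hd, h⟩ := W_lat (W.inv_mem hg) c
  rw [hc] at hd
  refine ⟨height d, ?_, by rw [W_inv_ip hg, h, ip_eq_height hρ]⟩
  rcases nonneg_or_nonpos_of_root hd with h0 | h0
  · exact (height_pos h0 (root_ne_zero hd)).ne'
  · have := height_pos (neg_nonneg.2 h0) (neg_ne_zero.2 (root_ne_zero hd))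
    have hn : height (-d) = - height d := by simp [height_eq_sum]
    omega

/-- If `g` maps every simple root to a positive root, then it fixes `ρ`. -/
lemma fixes_rho_of_nonneg {ρ : Fin 8 → ℝ} (hρ : ∀ i, ip ρ (sroot i) = 1)
    (hρd : ∀ d, (∀ i, 0 ≤ ip d (sroot i)) → 0 ≤ ip ρ d)
    {g : (Fin 8 → ℝ) ≃ₗ[ℝ] (Fin 8 → ℝ)} (hg : g ∈ W)
    (h : ∀ i, ∃ d, 0 ≤ d ∧ form d d = 2 ∧ g (sroot i) = lat d) : g ρ = ρ := by
  have hdom : 0 ≤ ip ρ (g⁻¹ ρ - ρ) := by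
    refine hρd _ fun i => ?_
    obtain ⟨d, h0, hd, hgd⟩ := h i
    have h1 : ip (g⁻¹ ρ) (sroot i) = height d := by
      rw [W_inv_ip (W.inv_mem hg), inv_inv, hgd, ip_eq_height hρ]
    have h2 : (1 : ℝ) ≤ height d := by exact_mod_cast height_pos h0 (root_ne_zero hd)
    have h3 := hρ i
    simp only [ip_eq_dotProduct] at *
    rw [sub_dotProduct]
    linarith
  have hnorm := W_ip (W.inv_mem hg) ρ ρ
  have hz : g⁻¹ ρ - ρ = 0 := by
    apply eq_zero_of_ip_self
    simp only [ip_eq_dotProduct, sub_dotProduct, dotProduct_sub] at *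
    rw [dotProduct_comm (g⁻¹ ρ) ρ]
    linarith
  rw [sub_eq_zero] at hz
  conv_lhs => rw [← hz]
  rw [← LinearEquiv.mul_apply, mul_inv_cancel]; rfl

/-- The root lattice coordinates of `ρ - v`, for `v` running over the strictly `Δ⁺(k)`-dominant
elements of the orbit of `ρ`. -/
def rhoDeficits : List (Fin 7 → ℤ) :=
  [![0, 0, 0, 0, 0, 0, 0], ![0, 0, 0, 0, 0, 0, 1], ![0, 0, 0, 0, 0, 1, 2],
   ![0, 0, 0, 0, 1, 2, 3], ![0, 0, 0, 1, 2, 3, 4], ![0, 1, 0, 2, 3, 4, 5],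
   ![0, 0, 1, 2, 3, 4, 5], ![0, 1, 1, 3, 4, 5, 6], ![1, 0, 2, 3, 4, 5, 6],
   ![0, 2, 2, 4, 5, 6, 7], ![1, 1, 2, 4, 5, 6, 7], ![1, 2, 3, 5, 6, 7, 8],
   ![0, 3, 3, 6, 6, 7, 8], ![2, 3, 4, 6, 7, 8, 9], ![1, 3, 4, 7, 7, 8, 9],
   ![0, 4, 4, 8, 8, 8, 9], ![2, 4, 5, 8, 8, 9, 10], ![1, 4, 5, 9, 9, 9, 10],
   ![0, 5, 5, 10, 10, 10, 10], ![3, 5, 6, 10, 9, 10, 11], ![2, 5, 6, 10, 10, 10, 11],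
   ![1, 5, 6, 11, 11, 11, 11], ![3, 6, 7, 12, 11, 11, 12], ![4, 6, 8, 12, 10, 11, 12],
   ![2, 6, 7, 12, 12, 12, 12], ![4, 7, 9, 14, 12, 12, 13], ![4, 7, 8, 14, 13, 12, 13],
   ![3, 7, 8, 14, 13, 13, 13], ![5, 8, 10, 16, 14, 13, 14], ![4, 8, 10, 16, 14, 14, 14],
   ![4, 8, 9, 16, 15, 14, 14], ![5, 9, 11, 18, 16, 15, 15], ![6, 9, 12, 18, 16, 14, 15],
   ![5, 9, 10, 18, 17, 16, 15], ![6, 10, 13, 20, 18, 16, 16], ![6, 10, 12, 20, 18, 17, 16],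
   ![7, 10, 14, 21, 18, 15, 16], ![7, 11, 14, 22, 20, 18, 17], ![7, 11, 15, 23, 20, 17, 17],
   ![8, 12, 16, 24, 20, 16, 17], ![8, 12, 16, 25, 22, 19, 18], ![8, 12, 16, 24, 22, 20, 18],
   ![8, 13, 17, 26, 22, 18, 18], ![9, 13, 18, 27, 24, 21, 19], ![9, 14, 18, 28, 24, 20, 19],
   ![10, 15, 20, 30, 26, 22, 20], ![10, 14, 20, 30, 26, 23, 20], ![11, 16, 22, 33, 28, 24, 21],
   ![11, 15, 22, 33, 29, 25, 21], ![12, 18, 24, 36, 30, 26, 22], ![12, 17, 24, 36, 31, 26, 22],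
   ![13, 19, 26, 39, 33, 28, 23], ![14, 21, 28, 42, 36, 30, 24], ![15, 23, 30, 46, 39, 32, 25],
   ![16, 25, 33, 50, 42, 34, 26], ![18, 27, 36, 54, 45, 36, 27]]

lemma rhoDeficits_dominant : ∀ c ∈ rhoDeficits, ∀ i : Fin 6, form c (unit i.castSucc) < 1 := by
  decide +kernel

lemma rhoDeficits_add_mem : ∀ c ∈ rhoDeficits, ∀ b ∈ noncompactRoots,
    height b - form c b = 1 → c + b ∈ rhoDeficits := by
  decide +kernel

lemma rhoDeficits_eq_zero_or : ∀ c ∈ rhoDeficits, c = 0 ∨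
    ∃ b ∈ noncompactRoots, form b b = 2 ∧ c - b ∈ rhoDeficits ∧ height b - form (c - b) b = 1 ∧
      height (c - b) < height c := by
  decide +kernel

lemma rhoDeficits_height_nonneg : ∀ c ∈ rhoDeficits, 0 ≤ height c := by
  decide +kernel

lemma card_rhoDeficits : rhoDeficits.toFinset.card = 56 := by
  decide +kernel

lemma ip_rho_sub_lat {ρ : Fin 8 → ℝ} (hρ : ∀ i, ip ρ (sroot i) = 1) (c d : Fin 7 → ℤ) :
    ip (ρ - lat c) (lat d) = height d - form c d := by
  rw [← ip_eq_height hρ, ← ip_lat_lat]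
  exact sub_dotProduct _ _ _

lemma rho_sub_lat_mem_orbit {ρ : Fin 8 → ℝ} (hρ : ∀ i, ip ρ (sroot i) = 1) {c : Fin 7 → ℤ}
    (hc : c ∈ rhoDeficits) : ∃ g ∈ W, ρ - lat c = g ρ := by
  obtain ⟨n, hn⟩ : ∃ n : ℕ, height c ≤ n := ⟨(height c).toNat, Int.self_le_toNat _⟩
  induction n generalizing c with
  | zero =>
    obtain rfl | ⟨b, -, -, hcb, -, hlt⟩ := rhoDeficits_eq_zero_or c hc
    · exact ⟨1, W.one_mem, by simp [lat_zero]⟩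
    · have := rhoDeficits_height_nonneg _ hcb
      push_cast at hn
      omega
  | succ n ih =>
    obtain rfl | ⟨b, -, hb, hcb, hone, hlt⟩ := rhoDeficits_eq_zero_or c hc
    · exact ⟨1, W.one_mem, by simp [lat_zero]⟩
    · obtain ⟨g, hg, h⟩ := ih hcb (by push_cast at hn; omega)
      obtain ⟨s, hs, hsv⟩ := exists_reflection_mem_W hb
      refine ⟨s * g, W.mul_mem hs hg, ?_⟩
      have : ip (ρ - lat (c - b)) (lat b) = 1 := by
        rw [ip_rho_sub_lat hρ]; exact_mod_cast hone
      rw [LinearEquiv.mul_apply, ← h, hsv, this, lat_sub]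
      module

lemma exists_rhoDeficit {ρ : Fin 8 → ℝ} (hρ : ∀ i, ip ρ (sroot i) = 1)
    (hρd : ∀ d, (∀ i, 0 ≤ ip d (sroot i)) → 0 ≤ ip ρ d)
    {g : (Fin 8 → ℝ) ≃ₗ[ℝ] (Fin 8 → ℝ)} (hg : g ∈ W)
    (hdom : ∀ i : Fin 6, 0 < ip (g ρ) (sroot i.castSucc)) :
    ∃ c ∈ rhoDeficits, ρ - lat c = g ρ := by
  obtain ⟨n, hn⟩ := exists_nat_gt (ip ρ ρ - ip (g ρ) ρ)
  induction n generalizing g with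
  | zero =>
    have h1 := ip_self_nonneg (g ρ - ρ)
    have h2 := W_ip hg ρ ρ
    simp only [ip_eq_dotProduct, sub_dotProduct, dotProduct_sub] at *
    rw [dotProduct_comm ρ (g ρ)] at h1
    push_cast at hn
    linarith
  | succ n ih =>
    by_cases hfix : g ρ = ρ
    · exact ⟨0, by decide, by simp [lat_zero, hfix]⟩
    obtain ⟨i, b, h0, hb, hgb⟩ : ∃ i b, 0 ≤ b ∧ form b b = 2 ∧ g (sroot i) = -lat b := by
      by_contra! h
      refine hfix (fixes_rho_of_nonneg hρ hρd hg fun i => ?_)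
      obtain ⟨d, hd, hgd⟩ := W_lat hg (unit i)
      rw [form_unit_self] at hd
      rw [lat_unit] at hgd
      refine ⟨d, (nonneg_or_nonpos_of_root hd).resolve_right fun hneg => ?_, hd, hgd⟩
      refine h i (-d) (neg_nonneg.2 hneg) ?_ (by rw [hgd, lat_neg, neg_neg])
      simpa [form] using hd
    have hvb : ip (g ρ) (lat b) = -1 := by
      have h1 := W_ip hg ρ (sroot i)
      rw [hρ, hgb, ip_eq_dotProduct, dotProduct_neg, ← ip_eq_dotProduct] at h1
      linarith
    have hb6 : 0 < b 6 := by
      refine lt_of_le_of_ne (h0 6) fun h6 => ?_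
      rw [ip_lat, Fin.sum_univ_castSucc] at hvb
      have h6' : b (Fin.last 6) = 0 := h6.symm
      have := Finset.sum_nonneg fun (j : Fin 6) (_ : j ∈ Finset.univ) =>
        mul_nonneg (show (0 : ℝ) ≤ b j.castSucc from by exact_mod_cast h0 j.castSucc) (hdom j).le
      rw [h6'] at hvb
      push_cast at hvb
      linarith
    obtain ⟨s, hs, hsv⟩ := exists_reflection_mem_W hb
    have hsg : (s * g) ρ = g ρ + lat b := by
      rw [LinearEquiv.mul_apply, hsv, hvb]
      module
    obtain ⟨c, hc, hcv⟩ := ih (W.mul_mem hs hg) (by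
      intro j
      obtain ⟨k, hk0, hk⟩ := exists_int_ip_orbit hρ (W.mul_mem hs hg) (form_unit_self j.castSucc)
      obtain ⟨l, -, hl⟩ := exists_int_ip_orbit hρ hg (form_unit_self j.castSucc)
      have hj := hdom j
      rw [← lat_unit, hl] at hj
      rw [← lat_unit, hk]
      have hkl : (k : ℝ) = l + form b (unit j.castSucc) := by
        rw [← hk, ← hl, ← ip_lat_lat, hsg]
        exact add_dotProduct _ _ _
      have hge := neg_one_le_form hb (form_unit_self j.castSucc) (by
        intro h
        rw [h] at hb6
        have : (6 : Fin 7) ≠ j.castSucc := (Fin.castSucc_lt_last j).ne'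
        simp [unit, this] at hb6)
      have hj' : 0 < l := by exact_mod_cast hj
      have hkl' : k = l + form b (unit j.castSucc) := by exact_mod_cast hkl
      have : 0 < k := by omega
      exact_mod_cast this) (by
      have h1 : (1 : ℝ) ≤ ip (lat b) ρ := by
        rw [ip_eq_dotProduct, dotProduct_comm, ← ip_eq_dotProduct, ip_eq_height hρ]
        exact_mod_cast height_pos h0 (root_ne_zero hb)
      rw [hsg]
      simp only [ip_eq_dotProduct, add_dotProduct] at *
      push_cast at hn
      linarith)
    refine ⟨c + b, rhoDeficits_add_mem c hc b (mem_noncompactRoots hb h0 hb6) ?_, ?_⟩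
    · have h1 := ip_rho_sub_lat hρ c b
      have h2 : ip (g ρ + lat b) (lat b) = ip (g ρ) (lat b) + ip (lat b) (lat b) :=
        add_dotProduct _ _ _
      rw [hcv, hsg, h2, hvb, ip_lat_lat, hb] at h1
      have : ((height b - form c b : ℤ) : ℝ) = 1 := by
        push_cast at h1 ⊢
        linarith
      exact_mod_cast this
    · rw [lat_add, ← sub_sub, hcv, hsg, add_sub_cancel_right]

/-- the set of vectors in W·ρ that are strictly Δ⁺(k)-dominant
has exactly 56 elements. -/
theorem e7_strictly_dominant_rho_orbit (sP : Finset (Fin 8 → ℝ))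
    (hsP : (sP : Set (Fin 8 → ℝ)) = PhiPos) :
    {v : Fin 8 → ℝ | (∃ g ∈ W, v = g ((1/2 : ℝ) • ∑ x ∈ sP, x)) ∧
        ∀ i : Fin 6, 0 < ip v (sroot i.castSucc)}.ncard = 56 := by
  have hρ := ip_rho_sroot hsP
  have hρd := fun d => ip_rho_nonneg (d := d) hsP
  generalize (1 / 2 : ℝ) • ∑ x ∈ sP, x = ρ at hρ hρd ⊢
  have hS : {v : Fin 8 → ℝ | (∃ g ∈ W, v = g ρ) ∧ ∀ i : Fin 6, 0 < ip v (sroot i.castSucc)}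
      = (fun c => ρ - lat c) '' (rhoDeficits.toFinset : Set (Fin 7 → ℤ)) := by
    ext v
    simp only [Set.mem_ofPred_eq, Set.mem_image, Finset.mem_coe, List.mem_toFinset]
    constructor
    · rintro ⟨⟨g, hg, rfl⟩, hdom⟩
      exact exists_rhoDeficit hρ hρd hg hdom
    · rintro ⟨c, hc, rfl⟩
      refine ⟨rho_sub_lat_mem_orbit hρ hc, fun i => ?_⟩
      have hh : height (unit i.castSucc) = 1 := by simp [height_eq_sum, unit]
      rw [← lat_unit, ip_rho_sub_lat hρ, hh]
      have : (form c (unit i.castSucc) : ℝ) < 1 := by exact_mod_cast rhoDeficits_dominant c hc i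
      push_cast
      linarith
  rw [hS, Set.ncard_image_of_injective _ fun c d h => lat_injective (sub_right_injective h),
    Set.ncard_coe_finset, card_rhoDeficits]

end E7
end

section
/- Let Λ' := ζ1 + ζ2 + ζ3 + ζ5 + ζ7. Then the set of Δ⁺(k)-dominant vectors of the form wΛ' − ρ_c with w ∈ W is exactly {ζ, −ζ}. (These are the highest weights of the two K̃-types in the Dirac cohomology of the Wallach module L(−8ζ) of E7(−25).) -/
open scoped BigOperators

namespace E7

lemma ip_add_left (x y z : Fin 8 → ℝ) : ip (x + y) z = ip x z + ip y z := by
  simp only [ip, Pi.add_apply, add_mul, Finset.sum_add_distrib]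

lemma ip_sub_smul_left (x y z : Fin 8 → ℝ) (c : ℝ) :
    ip (x - c • y) z = ip x z - c * ip y z := by
  simp only [ip, Fin.sum_univ_eight, Pi.sub_apply, Pi.smul_apply, smul_eq_mul]
  ring

lemma ip_sub_smul_self (v a : Fin 8 → ℝ) (ha : ip a a = 2) :
    ip (v - ip v a • a) (v - ip v a • a) = ip v v := by
  have h (c : ℝ) : ip (v - c • a) (v - c • a) = ip v v - 2 * c * ip v a + c ^ 2 * ip a a := by
    simp only [ip, Fin.sum_univ_eight, Pi.sub_apply, Pi.smul_apply, smul_eq_mul]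
    ring
  rw [h, ha]
  ring

lemma ip_sum_smul_right (v : Fin 8 → ℝ) (c : Fin 7 → ℝ) (w : Fin 7 → Fin 8 → ℝ) :
    ip v (∑ j, c j • w j) = ∑ j, c j * ip v (w j) := by
  simp only [ip, Fin.sum_univ_eight, Fin.sum_univ_seven, Pi.add_apply, Pi.smul_apply, smul_eq_mul]
  ring

lemma ip_sq_le (v w : Fin 8 → ℝ) : ip v w ^ 2 ≤ ip v v * ip w w := by
  have h := Finset.sum_mul_sq_le_sq_mul_sq Finset.univ v w
  simpa only [ip, pow_two] using h

/-- The coordinates of a linear combination of the simple roots. -/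
lemma sum_smul_sroot (c : Fin 7 → ℝ) :
    ∑ j, c j • sroot j =
      ![c 0 / 2 + c 1 - c 2, -c 0 / 2 + c 1 + c 2 - c 3, -c 0 / 2 + c 3 - c 4,
        -c 0 / 2 + c 4 - c 5, -c 0 / 2 + c 5 - c 6, -c 0 / 2 + c 6, -c 0 / 2, c 0 / 2] := by
  ext i
  fin_cases i <;> simp [sroot, Fin.sum_univ_seven] <;> ring

lemma ip_sroot (v : Fin 8 → ℝ) (j : Fin 7) :
    ip v (sroot j) =
      ![(v 0 - v 1 - v 2 - v 3 - v 4 - v 5 - v 6 + v 7) / 2, v 0 + v 1, v 1 - v 0, v 2 - v 1,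
        v 3 - v 2, v 4 - v 3, v 5 - v 4] j := by
  fin_cases j <;> simp [ip, sroot, Fin.sum_univ_eight] <;> ring

lemma coord_six_eq_of_mem_latQ {v : Fin 8 → ℝ} (hv : v ∈ latQ) : v 6 = -v 7 := by
  obtain ⟨c, rfl⟩ := hv
  rw [sum_smul_sroot]
  simp
  ring

lemma coord_six_eq_of_mem_span {v : Fin 8 → ℝ}
    (hv : v ∈ Submodule.span ℝ (Set.range sroot)) : v 6 = -v 7 := by
  obtain ⟨c, rfl⟩ := (Submodule.mem_span_range_iff_exists_fun ℝ).1 hv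
  rw [sum_smul_sroot]
  simp
  ring

lemma ip_sroot_sroot (i j : Fin 7) : ∃ m : ℤ, ip (sroot i) (sroot j) = m := by
  rw [ip_sroot]
  fin_cases i <;> fin_cases j <;>
    first
    | (refine ⟨0, ?_⟩; simp [sroot] <;> norm_num; done)
    | (refine ⟨-1, ?_⟩; simp [sroot] <;> norm_num; done)
    | (refine ⟨2, ?_⟩; simp [sroot] <;> norm_num; done)

/-- A Weyl group element preserves the norm, the span of the roots and the weight lattice. -/
lemma W_preserves {g : (Fin 8 → ℝ) ≃ₗ[ℝ] (Fin 8 → ℝ)} (hg : g ∈ W) :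
    ∀ v : Fin 8 → ℝ, v 6 = -v 7 → (∀ j, ∃ n : ℤ, ip v (sroot j) = n) →
      ip (g v) (g v) = ip v v ∧ g v 6 = -g v 7 ∧ ∀ j, ∃ n : ℤ, ip (g v) (sroot j) = n := by
  have key : ∀ h : (Fin 8 → ℝ) ≃ₗ[ℝ] (Fin 8 → ℝ), ∀ a ∈ Phi, (∀ v, h v = v - ip v a • a) →
      ∀ v : Fin 8 → ℝ, v 6 = -v 7 → (∀ j, ∃ n : ℤ, ip v (sroot j) = n) →
      ip (h v) (h v) = ip v v ∧ h v 6 = -h v 7 ∧ ∀ j, ∃ n : ℤ, ip (h v) (sroot j) = n := by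
    rintro h a ⟨haQ, ha⟩ hh v hv hint
    rw [hh]
    refine ⟨ip_sub_smul_self v a ha, ?_, fun j => ?_⟩
    · simp only [Pi.sub_apply, Pi.smul_apply, smul_eq_mul, hv, coord_six_eq_of_mem_latQ haQ]
      ring
    · obtain ⟨c, rfl⟩ := haQ
      choose n hn using hint
      have hroot := fun i => ip_sroot_sroot i j
      choose m hm using hroot
      have hcomm (x y : Fin 8 → ℝ) : ip x y = ip y x := by simp only [ip, mul_comm]
      refine ⟨n j - (∑ i, c i * n i) * ∑ i, c i * m i, ?_⟩
      rw [ip_sub_smul_left, hcomm (∑ i, (c i : ℝ) • sroot i) (sroot j),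
        ip_sum_smul_right v (fun i => (c i : ℝ)), ip_sum_smul_right (sroot j) (fun i => (c i : ℝ))]
      simp only [hn, hcomm (sroot j), hm]
      push_cast
      ring
  induction hg using Subgroup.closure_induction'' with
  | mem h hh =>
    obtain ⟨a, ha, hh⟩ := hh
    exact key h a ha hh
  | inv_mem h hh =>
    obtain ⟨a, ha, hh⟩ := hh
    refine key h⁻¹ a ha fun v => ?_
    apply h.injective
    refine (h.apply_symm_apply v).trans ?_
    rw [hh, ip_sub_smul_left, ha.2]
    module
  | one => exact fun v hv hint => ⟨rfl, hv, hint⟩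
  | mul x y _ _ hx hy =>
    intro v hv hint
    obtain ⟨h1, h2, h3⟩ := hy v hv hint
    obtain ⟨h4, h5, h6⟩ := hx (y v) h2 h3
    exact ⟨h4.trans h1, h5, h6⟩

/-- The reflection in a root, as an element of the Weyl group. -/
lemma exists_mem_W_reflection {a : Fin 8 → ℝ} (ha : a ∈ Phi) :
    ∃ g ∈ W, ∀ v, g v = v - ip v a • a := by
  let f : Module.Dual ℝ (Fin 8 → ℝ) := ∑ i, a i • LinearMap.proj i
  have hf (v : Fin 8 → ℝ) : f v = ip v a := by
    simp [f, ip, mul_comm]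
  have h2 : f a = 2 := (hf a).trans ha.2
  have hg (v : Fin 8 → ℝ) : Module.reflection h2 v = v - ip v a • a := by
    rw [Module.reflection_apply, hf]
  exact ⟨Module.reflection h2, Subgroup.subset_closure ⟨a, ha, hg⟩, hg⟩

/-- Two vectors are conjugate under the Weyl group. -/
def WConj (v w : Fin 8 → ℝ) : Prop := ∃ g ∈ W, g v = w

lemma WConj.trans {u v w : Fin 8 → ℝ} (h : WConj u v) (h' : WConj v w) : WConj u w := by
  obtain ⟨g, hg, rfl⟩ := h
  obtain ⟨g', hg', rfl⟩ := h'
  exact ⟨g' * g, mul_mem hg' hg, rfl⟩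

/-- A vector is conjugate to its image under the reflection in the root `∑ j, c j • sroot j`. -/
lemma wConj_of_reflection (c : Fin 7 → ℤ) (v w a : Fin 8 → ℝ)
    (hc : a = ∑ j, (c j : ℝ) • sroot j) (ha : ip a a = 2) (hw : v - ip v a • a = w) :
    WConj v w := by
  obtain ⟨g, hg, h⟩ := exists_mem_W_reflection (a := a) ⟨⟨c, hc⟩, ha⟩
  exact ⟨g, hg, (h v).trans hw⟩

/-- The half sum of the positive compact roots, in coordinates. -/
noncomputable def rhoC : Fin 8 → ℝ := ![0, 1, 2, 3, 4, -4, -4, 4]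

/-- The weight `ζ₁ + ζ₂ + ζ₃ + ζ₅ + ζ₇`, in coordinates. -/
noncomputable def lam : Fin 8 → ℝ := ![0, 1, 1, 2, 2, 3, -11/2, 11/2]

lemma wConj_lam_zeta_add_rhoC : WConj lam (zeta + rhoC) := by
  have h1 : WConj lam ![2, 1, 1, 2, 0, 3, -11/2, 11/2] :=
    wConj_of_reflection ![0, 0, 1, 1, 1, 1, 0] _ _ ![-1, 0, 0, 0, 1, 0, 0, 0]
      (by rw [sum_smul_sroot]; ext i; fin_cases i <;> simp)
      (by simp [ip, Fin.sum_univ_eight]; norm_num)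
      (by ext i; fin_cases i <;> simp [ip, lam, Fin.sum_univ_eight])
  have h2 : WConj ![2, 1, 1, 2, 0, 3, -11/2, 11/2] ![-1, -2, 1, 2, 0, 3, -11/2, 11/2] :=
    wConj_of_reflection ![0, 1, 0, 0, 0, 0, 0] _ _ ![1, 1, 0, 0, 0, 0, 0, 0]
      (by rw [sum_smul_sroot]; ext i; fin_cases i <;> simp)
      (by simp [ip, Fin.sum_univ_eight]; norm_num)
      (by ext i; fin_cases i <;> simp [ip, Fin.sum_univ_eight])
  have h3 : WConj ![-1, -2, 1, 2, 0, 3, -11/2, 11/2] ![1, 0, 3, 4, -2, 5, -7/2, 7/2] :=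
    wConj_of_reflection ![1, 0, 1, 1, 1, 1, 0] _ _ ![-1/2, -1/2, -1/2, -1/2, 1/2, -1/2, -1/2, 1/2]
      (by rw [sum_smul_sroot]; ext i; fin_cases i <;> simp <;> norm_num)
      (by simp [ip, Fin.sum_univ_eight]; norm_num)
      (by ext i; fin_cases i <;> simp [ip, Fin.sum_univ_eight] <;> norm_num)
  have h4 : WConj ![1, 0, 3, 4, -2, 5, -7/2, 7/2] ![0, 1, 2, 3, -3, 4, -9/2, 9/2] :=
    wConj_of_reflection ![1, 0, 1, 0, 0, 0, 0] _ _ ![-1/2, 1/2, -1/2, -1/2, -1/2, -1/2, -1/2, 1/2]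
      (by rw [sum_smul_sroot]; ext i; fin_cases i <;> simp <;> norm_num)
      (by simp [ip, Fin.sum_univ_eight]; norm_num)
      (by ext i; fin_cases i <;> simp [ip, Fin.sum_univ_eight] <;> norm_num)
  have h5 : WConj ![0, 1, 2, 3, -3, 4, -9/2, 9/2] (zeta + rhoC) :=
    wConj_of_reflection ![0, 0, 0, 0, 0, 0, 1] _ _ ![0, 0, 0, 0, -1, 1, 0, 0]
      (by rw [sum_smul_sroot]; ext i; fin_cases i <;> simp)
      (by simp [ip, Fin.sum_univ_eight]; norm_num)
      (by ext i; fin_cases i <;> simp [ip, rhoC, zeta, Fin.sum_univ_eight] <;> norm_num)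
  exact (((h1.trans h2).trans h3).trans h4).trans h5

lemma wConj_zeta_add_rhoC_neg_zeta_add_rhoC : WConj (zeta + rhoC) (-zeta + rhoC) := by
  have h1 : WConj (zeta + rhoC) ![1/2, 1/2, 3/2, 7/2, 9/2, -7/2, -4, 4] :=
    wConj_of_reflection ![1, 1, 2, 2, 1, 1, 1] _ _ ![-1/2, 1/2, 1/2, -1/2, -1/2, 1/2, -1/2, 1/2]
      (by rw [sum_smul_sroot]; ext i; fin_cases i <;> simp <;> norm_num)
      (by simp [ip, Fin.sum_univ_eight]; norm_num)
      (by ext i; fin_cases i <;> simp [ip, rhoC, zeta, Fin.sum_univ_eight] <;> norm_num)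
  have h2 : WConj ![1/2, 1/2, 3/2, 7/2, 9/2, -7/2, -4, 4] ![1/2, 1/2, 3/2, 7/2, 7/2, -9/2, -4, 4] :=
    wConj_of_reflection ![0, 1, 1, 2, 2, 2, 1] _ _ ![0, 0, 0, 0, 1, 1, 0, 0]
      (by rw [sum_smul_sroot]; ext i; fin_cases i <;> simp <;> norm_num)
      (by simp [ip, Fin.sum_univ_eight]; norm_num)
      (by ext i; fin_cases i <;> simp [ip, Fin.sum_univ_eight] <;> norm_num)
  have h3 : WConj ![1/2, 1/2, 3/2, 7/2, 7/2, -9/2, -4, 4] (-zeta + rhoC) :=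
    wConj_of_reflection ![1, 1, 1, 2, 2, 1, 1] _ _ ![1/2, -1/2, -1/2, 1/2, -1/2, 1/2, -1/2, 1/2]
      (by rw [sum_smul_sroot]; ext i; fin_cases i <;> simp <;> norm_num)
      (by simp [ip, Fin.sum_univ_eight]; norm_num)
      (by ext i; fin_cases i <;> simp [ip, rhoC, zeta, Fin.sum_univ_eight] <;> norm_num)
  exact (h1.trans h2).trans h3

/-- Coefficient vectors bounded by those of the highest root of `E₆`. -/
abbrev Coeffs : Type := Fin 2 × Fin 3 × Fin 3 × Fin 4 × Fin 3 × Fin 2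

/-- The coefficients of the positive roots of `E₆`. -/
def posCoeffs : Finset Coeffs :=
  Finset.univ.filter fun (a, b, c, d, e, f) =>
    a.1 ^ 2 + b.1 ^ 2 + c.1 ^ 2 + d.1 ^ 2 + e.1 ^ 2 + f.1 ^ 2 =
      1 + a.1 * c.1 + c.1 * d.1 + b.1 * d.1 + d.1 * e.1 + e.1 * f.1

/-- The coefficients of an element of `Coeffs` on the simple roots of `E₇`. -/
def Coeffs.toFun : Coeffs → Fin 7 → ℕ
  | (a, b, c, d, e, f) => ![a, b, c, d, e, f, 0]

/-- The linear combination of the simple roots with the given coefficients. -/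
noncomputable def Coeffs.toVec (p : Coeffs) : Fin 8 → ℝ := ∑ j, (p.toFun j : ℝ) • sroot j

lemma ip_sum_smul_sroot_self (c : Fin 7 → ℝ) :
    ip (∑ j, c j • sroot j) (∑ j, c j • sroot j) =
      2 * (c 0 ^ 2 + c 1 ^ 2 + c 2 ^ 2 + c 3 ^ 2 + c 4 ^ 2 + c 5 ^ 2 + c 6 ^ 2
        - (c 0 * c 2 + c 2 * c 3 + c 1 * c 3 + c 3 * c 4 + c 4 * c 5 + c 5 * c 6)) := by
  rw [sum_smul_sroot]
  simp [ip, Fin.sum_univ_eight]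
  ring

lemma ip_sum_smul_sroot_zeta (c : Fin 7 → ℝ) : ip (∑ j, c j • sroot j) zeta = c 6 := by
  rw [sum_smul_sroot]
  simp [ip, zeta, Fin.sum_univ_eight]
  ring

lemma Coeffs.toVec_injective : Function.Injective Coeffs.toVec := by
  intro p q h
  have h' (i : Fin 8) := congrFun h i
  simp only [Coeffs.toVec, sum_smul_sroot] at h'
  obtain ⟨a, b, c, d, e, f⟩ := p
  obtain ⟨a', b', c', d', e', f'⟩ := q
  have h1 := h' 1
  have h2 := h' 2
  have h3 := h' 3
  have h4 := h' 4
  have h5 := h' 0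
  have h7 := h' 7
  simp [Coeffs.toFun] at h1 h2 h3 h4 h5 h7
  have ea : ((a : ℕ) : ℝ) = (a' : ℕ) := by exact_mod_cast h7
  have ef : ((f : ℕ) : ℝ) = (f' : ℕ) := by linarith
  have ee : ((e : ℕ) : ℝ) = (e' : ℕ) := by linarith
  have ed : ((d : ℕ) : ℝ) = (d' : ℕ) := by linarith
  have ec : ((c : ℕ) : ℝ) = (c' : ℕ) := by linarith
  have eb : ((b : ℕ) : ℝ) = (b' : ℕ) := by linarith
  simp only [Prod.mk.injEq, Fin.ext_iff]
  exact ⟨by exact_mod_cast ea, by exact_mod_cast eb, by exact_mod_cast ec, by exact_mod_cast ed,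
    by exact_mod_cast ee, by exact_mod_cast ef⟩

/-- If `v` has norm two and `2 * ip w w < m ^ 2`, then a natural number equal to `ip v w` is
less than `m`. -/
lemma coeff_lt {v w : Fin 8 → ℝ} {n m : ℕ} (hv : ip v v = 2) (hn : ip v w = n)
    (hw : 2 * ip w w < (m : ℝ) ^ 2) : n < m := by
  have h := ip_sq_le v w
  rw [hn, hv] at h
  have h' : (n : ℝ) ^ 2 < (m : ℝ) ^ 2 := h.trans_lt hw
  exact_mod_cast lt_of_pow_lt_pow_left₀ 2 (Nat.cast_nonneg m) h'

lemma phiPosK_eq : PhiPosK = Coeffs.toVec '' (posCoeffs : Set Coeffs) := by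
  ext v
  constructor
  · rintro ⟨⟨⟨-, hv⟩, c, rfl⟩, hz⟩
    rw [ip_sum_smul_sroot_zeta (fun j => (c j : ℝ))] at hz
    have h0 : c 0 < 2 := coeff_lt (w := ![0, 0, 0, 0, 0, -2/3, -2/3, 2/3]) hv
      (by rw [sum_smul_sroot (fun j => (c j : ℝ))]; simp [ip, Fin.sum_univ_eight, hz]; ring)
      (by simp [ip, Fin.sum_univ_eight]; norm_num)
    have h1 : c 1 < 3 := coeff_lt (w := ![1/2, 1/2, 1/2, 1/2, 1/2, -1/2, -1/2, 1/2]) hv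
      (by rw [sum_smul_sroot (fun j => (c j : ℝ))]; simp [ip, Fin.sum_univ_eight, hz]; ring)
      (by simp [ip, Fin.sum_univ_eight]; norm_num)
    have h2 : c 2 < 3 := coeff_lt (w := ![-1/2, 1/2, 1/2, 1/2, 1/2, -5/6, -5/6, 5/6]) hv
      (by rw [sum_smul_sroot (fun j => (c j : ℝ))]; simp [ip, Fin.sum_univ_eight, hz]; ring)
      (by simp [ip, Fin.sum_univ_eight]; norm_num)
    have h3 : c 3 < 4 := coeff_lt (w := ![0, 0, 1, 1, 1, -1, -1, 1]) hv
      (by rw [sum_smul_sroot (fun j => (c j : ℝ))]; simp [ip, Fin.sum_univ_eight, hz]; ring)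
      (by simp [ip, Fin.sum_univ_eight]; norm_num)
    have h4 : c 4 < 3 := coeff_lt (w := ![0, 0, 0, 1, 1, -2/3, -2/3, 2/3]) hv
      (by rw [sum_smul_sroot (fun j => (c j : ℝ))]; simp [ip, Fin.sum_univ_eight, hz]; ring)
      (by simp [ip, Fin.sum_univ_eight]; norm_num)
    have h5 : c 5 < 2 := coeff_lt (w := ![0, 0, 0, 0, 1, -1/3, -1/3, 1/3]) hv
      (by rw [sum_smul_sroot (fun j => (c j : ℝ))]; simp [ip, Fin.sum_univ_eight, hz]; ring)
      (by simp [ip, Fin.sum_univ_eight]; norm_num)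
    rw [ip_sum_smul_sroot_self (fun j => (c j : ℝ))] at hv
    refine ⟨(⟨c 0, h0⟩, ⟨c 1, h1⟩, ⟨c 2, h2⟩, ⟨c 3, h3⟩, ⟨c 4, h4⟩, ⟨c 5, h5⟩), ?_, ?_⟩
    · simp only [posCoeffs, Finset.coe_filter, Finset.mem_univ, true_and, Set.mem_ofPred_eq]
      rw [hz] at hv
      have : ((c 0 : ℝ) ^ 2 + (c 1 : ℝ) ^ 2 + (c 2 : ℝ) ^ 2 + (c 3 : ℝ) ^ 2 + (c 4 : ℝ) ^ 2
          + (c 5 : ℝ) ^ 2) = 1 + c 0 * c 2 + c 2 * c 3 + c 1 * c 3 + c 3 * c 4 + c 4 * c 5 := by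
        linarith
      exact_mod_cast this
    · have hz' : c 6 = 0 := by exact_mod_cast hz
      refine Finset.sum_congr rfl fun j _ => ?_
      fin_cases j <;> simp [Coeffs.toFun, hz']
  · rintro ⟨⟨a, b, c, d, e, f⟩, hp, rfl⟩
    simp only [posCoeffs, Finset.coe_filter, Finset.mem_univ, true_and, Set.mem_ofPred_eq] at hp
    have hp' : ((a : ℕ) : ℝ) ^ 2 + ((b : ℕ) : ℝ) ^ 2 + ((c : ℕ) : ℝ) ^ 2 + ((d : ℕ) : ℝ) ^ 2
        + ((e : ℕ) : ℝ) ^ 2 + ((f : ℕ) : ℝ) ^ 2 =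
        1 + (a : ℕ) * (c : ℕ) + (c : ℕ) * (d : ℕ) + (b : ℕ) * (d : ℕ) + (d : ℕ) * (e : ℕ)
          + (e : ℕ) * (f : ℕ) := by
      exact_mod_cast hp
    refine ⟨⟨⟨⟨fun j => (Coeffs.toFun (a, b, c, d, e, f) j : ℤ), by simp [Coeffs.toVec]⟩, ?_⟩,
      Coeffs.toFun (a, b, c, d, e, f), rfl⟩, ?_⟩
    · rw [Coeffs.toVec, ip_sum_smul_sroot_self (fun j => (Coeffs.toFun _ j : ℝ))]
      simp [Coeffs.toFun]
      linarith
    · rw [Coeffs.toVec, ip_sum_smul_sroot_zeta (fun j => (Coeffs.toFun _ j : ℝ))]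
      simp [Coeffs.toFun]

lemma sum_posCoeffs (j : Fin 7) :
    ∑ p ∈ posCoeffs, p.toFun j = ![16, 22, 30, 42, 30, 16, 0] j := by
  revert j
  decide

lemma half_sum_phiPosK (sK : Finset (Fin 8 → ℝ)) (hsK : (sK : Set (Fin 8 → ℝ)) = PhiPosK) :
    (1 / 2 : ℝ) • ∑ y ∈ sK, y = rhoC := by
  classical
  have h : sK = posCoeffs.image Coeffs.toVec := by
    rw [← Finset.coe_inj, hsK, phiPosK_eq, Finset.coe_image]
  rw [h, Finset.sum_image Coeffs.toVec_injective.injOn]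
  simp only [Coeffs.toVec]
  rw [Finset.sum_comm]
  simp only [← Finset.sum_smul, ← Nat.cast_sum, sum_posCoeffs]
  rw [sum_smul_sroot (fun j => ((![16, 22, 30, 42, 30, 16, 0] j : ℕ) : ℝ))]
  ext i
  fin_cases i <;> simp [rhoC] <;> norm_num

lemma ip_rhoC_sroot (i : Fin 6) : ip rhoC (sroot i.castSucc) = 1 := by
  rw [ip_sroot]
  fin_cases i <;> simp [rhoC] <;> norm_num

/-- An integral vector with the norm of `lam` whose difference with `rhoC` is dominant for the
compact roots differs from `rhoC` by `ζ` or `-ζ`. -/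
lemma sub_rhoC_eq_of_dominant {x : Fin 8 → ℝ} (hx : ip x x = 159 / 2) (h67 : x 6 = -x 7)
    (hint : ∀ j, ∃ n : ℤ, ip x (sroot j) = n)
    (hdom : ∀ i : Fin 6, 0 ≤ ip (x - rhoC) (sroot i.castSucc)) :
    x - rhoC = zeta ∨ x - rhoC = -zeta := by
  obtain ⟨u, rfl⟩ : ∃ u, x = u + rhoC := ⟨x - rhoC, by simp⟩
  rw [add_sub_cancel_right] at hdom ⊢
  have hnat : ∀ i : Fin 6, ∃ n : ℕ, ip u (sroot i.castSucc) = n := by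
    intro i
    obtain ⟨n, hn⟩ := hint i.castSucc
    have hn' : ip u (sroot i.castSucc) = ((n - 1 : ℤ) : ℝ) := by
      push_cast
      rw [← hn]
      rw [ip_add_left, ip_rhoC_sroot]
      ring
    have h0 := hdom i
    rw [hn'] at h0
    obtain ⟨m, hm⟩ := Int.eq_ofNat_of_zero_le (Int.cast_nonneg_iff.1 h0)
    exact ⟨m, by rw [hn', hm]; simp⟩
  choose n hn using hnat
  have e0 := hn 0
  have e1 := hn 1
  have e2 := hn 2
  have e3 := hn 3
  have e4 := hn 4
  have e5 := hn 5
  simp [ip_sroot] at e0 e1 e2 e3 e4 e5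
  simp [rhoC] at h67
  simp [ip, rhoC, Fin.sum_univ_eight] at hx
  have hlt : (16 * n 0 + 22 * n 1 + 30 * n 2 + 42 * n 3 + 30 * n 4 + 16 * n 5 : ℝ) < 2 := by
    rw [← e0, ← e1, ← e2, ← e3, ← e4, ← e5]
    nlinarith [sq_nonneg (u 0), sq_nonneg (u 1), sq_nonneg (u 2), sq_nonneg (u 3),
      sq_nonneg (u 4), sq_nonneg (u 5), sq_nonneg (u 6), sq_nonneg (u 7)]
  have hlt' : 16 * n 0 + 22 * n 1 + 30 * n 2 + 42 * n 3 + 30 * n 4 + 16 * n 5 < 2 := by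
    exact_mod_cast hlt
  have z0 : n 0 = 0 := by omega
  have z1 : n 1 = 0 := by omega
  have z2 : n 2 = 0 := by omega
  have z3 : n 3 = 0 := by omega
  have z4 : n 4 = 0 := by omega
  have z5 : n 5 = 0 := by omega
  simp only [z0, z1, z2, z3, z4, z5, Nat.cast_zero] at e0 e1 e2 e3 e4 e5
  have u0 : u 0 = 0 := by linarith
  have u1 : u 1 = 0 := by linarith
  have u2 : u 2 = 0 := by linarith
  have u3 : u 3 = 0 := by linarith
  have u4 : u 4 = 0 := by linarith
  have u6 : u 6 = -(u 5) / 2 := by linarith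
  have u7 : u 7 = u 5 / 2 := by linarith
  rw [u0, u1, u2, u3, u4, u6, u7] at hx
  have hsq : u 5 * u 5 = 1 := by linarith
  rcases mul_self_eq_one_iff.1 hsq with h | h
  · left
    ext i
    fin_cases i <;> simp [zeta, u0, u1, u2, u3, u4, u6, u7, h]
  · right
    ext i
    fin_cases i <;> simp [zeta, u0, u1, u2, u3, u4, u6, u7, h] <;> norm_num

lemma fw_sum_eq_lam (fw : Fin 7 → Fin 8 → ℝ)
    (hfw_span : ∀ i, fw i ∈ Submodule.span ℝ (Set.range sroot))
    (hfw_pair : ∀ i j, ip (fw i) (sroot j) = if i = j then 1 else 0) :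
    fw 0 + fw 1 + fw 2 + fw 4 + fw 6 = lam := by
  have h67 (i) := coord_six_eq_of_mem_span (hfw_span i)
  obtain ⟨v, hv⟩ : ∃ v, v = fw 0 + fw 1 + fw 2 + fw 4 + fw 6 := ⟨_, rfl⟩
  have hv67 : v 6 = -v 7 := by
    simp only [hv, Pi.add_apply, h67]
    ring
  have hpair (j) : ip v (sroot j) = ![1, 1, 1, 0, 1, 0, 1] j := by
    simp only [hv, ip_add_left, hfw_pair]
    fin_cases j <;> simp
  simp only [ip_sroot] at hpair
  rw [← hv]
  have e0 := hpair 0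
  have e1 := hpair 1
  have e2 := hpair 2
  have e3 := hpair 3
  have e4 := hpair 4
  have e5 := hpair 5
  have e6 := hpair 6
  simp at e0 e1 e2 e3 e4 e5 e6
  ext i
  fin_cases i <;> simp [lam] <;> linarith

lemma ip_lam_sroot (j : Fin 7) : ∃ n : ℤ, ip lam (sroot j) = n := by
  refine ⟨![1, 1, 1, 0, 1, 0, 1] j, ?_⟩
  fin_cases j <;> simp [ip_sroot, lam] <;> norm_num

/-- for Λ' = ζ₁+ζ₂+ζ₃+ζ₅+ζ₇, the Δ⁺(k)-dominant vectors of the form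
wΛ' − ρ_c (w ∈ W) are exactly ζ and −ζ (the highest weights of the two K̃-types in the
Dirac cohomology of the Wallach module L(−8ζ)). -/
theorem e7_dirac_cohomology_wallach8
    (fw : Fin 7 → Fin 8 → ℝ)
    (hfw_span : ∀ i, fw i ∈ Submodule.span ℝ (Set.range sroot))
    (hfw_pair : ∀ i j, ip (fw i) (sroot j) = if i = j then 1 else 0)
    (sK : Finset (Fin 8 → ℝ)) (hsK : (sK : Set (Fin 8 → ℝ)) = PhiPosK) :
    {u : Fin 8 → ℝ |
        (∃ g ∈ W, u = g (fw 0 + fw 1 + fw 2 + fw 4 + fw 6) -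
          (1/2 : ℝ) • ∑ y ∈ sK, y) ∧
        ∀ i : Fin 6, 0 ≤ ip u (sroot i.castSucc)} = {zeta, -zeta} := by
  rw [fw_sum_eq_lam fw hfw_span hfw_pair, half_sum_phiPosK sK hsK]
  ext u
  simp only [Set.mem_ofPred_eq, Set.mem_insert_iff, Set.mem_singleton_iff]
  constructor
  · rintro ⟨⟨g, hg, rfl⟩, hdom⟩
    obtain ⟨h1, h2, h3⟩ := W_preserves hg lam (by simp [lam]; norm_num) ip_lam_sroot
    refine sub_rhoC_eq_of_dominant (h1.trans ?_) h2 h3 hdom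
    simp [ip, lam, Fin.sum_univ_eight]; norm_num
  · rintro (rfl | rfl)
    · obtain ⟨g, hg, h⟩ := wConj_lam_zeta_add_rhoC
      refine ⟨⟨g, hg, by rw [h, add_sub_cancel_right]⟩, fun i => ?_⟩
      fin_cases i <;> simp [ip_sroot, zeta]; norm_num
    · obtain ⟨g, hg, h⟩ :=
        wConj_lam_zeta_add_rhoC.trans wConj_zeta_add_rhoC_neg_zeta_add_rhoC
      refine ⟨⟨g, hg, by rw [h, add_sub_cancel_right]⟩, fun i => ?_⟩
      fin_cases i <;> simp [ip_sroot, zeta]; norm_num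

end E7
end
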